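/- There exist an integer $d \ge 2$, a constant $a > 0$, an infinite set of integers $n$, $d$-regular digraphs $G_n$ on $n$ vertices, and positive integers $k_n$ with $k_n \ge a \log n$, such that the sequence of random chains $Q_n = M_n^{k_n}\Pi_n$ (where $M_n$ is the simple random walk matrix of $G_n$ and $\Pi_n$ is the matrix of a uniformly random permutation of the vertex set) does not exhibit cutoff: there is no sequence of times $(t_n)$ such that for every fixed $\eta \in (0,1)$, $\mathcal{D}^{(n)}(\lceil (1+\eta) t_n \rceil) \to 0$ in probability and $\mathcal{D}^{(n)}(\lfloor (1-\eta) t_n \rfloor) \to 1$ in probability. -/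

import Mathlib

open Finset Filter

noncomputable section

/-- A bistochastic matrix: nonnegative entries, all rows and columns sum to 1. -/
def Bistochastic {n : ℕ} (P : Matrix (Fin n) (Fin n) ℝ) : Prop :=
  (∀ x y, 0 ≤ P x y) ∧ (∀ x, ∑ y, P x y = 1) ∧ (∀ y, ∑ x, P x y = 1)

/-- The permutation matrix of a permutation: `Π x y = 1` iff `y = π x`. -/
def permMatrix {n : ℕ} (π : Equiv.Perm (Fin n)) : Matrix (Fin n) (Fin n) ℝ :=
  fun x y => if y = π x then 1 else 0

/-- Entropy rate of a bistochastic matrix. -/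
def entRate {n : ℕ} (P : Matrix (Fin n) (Fin n) ℝ) : ℝ :=
  (1 / n) * ∑ x, ∑ y, if 0 < P x y then P x y * Real.log (1 / P x y) else 0

/-- Minimal positive entry. -/
def minPosEntry {n : ℕ} (P : Matrix (Fin n) (Fin n) ℝ) : ℝ :=
  sInf {r : ℝ | 0 < r ∧ ∃ x y, P x y = r}

/-- Total variation distance to uniform at time `t` from `x`. -/
def tvFrom {n : ℕ} (Q : Matrix (Fin n) (Fin n) ℝ) (t : ℕ) (x : Fin n) : ℝ :=
  ∑ y, max ((1 : ℝ) / n - (Q ^ t) x y) 0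

/-- Worst-case total variation distance at time `t`. -/
def worstTV {n : ℕ} (Q : Matrix (Fin n) (Fin n) ℝ) (t : ℕ) : ℝ :=
  ⨆ x, tvFrom Q t x

/-- Mixing time. -/
def mixingTime {n : ℕ} (Q : Matrix (Fin n) (Fin n) ℝ) (ε : ℝ) : ℕ :=
  sInf {t : ℕ | worstTV Q t ≤ ε}

open Classical in
/-- Probability of an event under the uniform distribution on permutations. -/
def probPerm {n : ℕ} (E : Equiv.Perm (Fin n) → Prop) : ℝ :=
  (Finset.univ.filter E).card / (Fintype.card (Equiv.Perm (Fin n)))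


open Classical in
/-- Transition matrix of the simple random walk on a digraph with edge relation `E`
in which every out-degree is `d`. -/
def walkMatrix {n : ℕ} (d : ℕ) (E : Fin n → Fin n → Prop) : Matrix (Fin n) (Fin n) ℝ :=
  fun u v => if E u v then 1 / d else 0

open Classical in
/-- A digraph is `d`-regular if every vertex has in-degree and out-degree `d`. -/
def IsRegularDigraph {n : ℕ} (d : ℕ) (E : Fin n → Fin n → Prop) : Prop :=
  ∀ v : Fin n, (Finset.univ.filter fun u => E u v).card = d ∧
    (Finset.univ.filter fun w => E v w).card = d

section Graph

variable {V : Type*}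

open Classical in
/-- Transition matrix of the walk on a `3`-regular digraph over an arbitrary vertex type. -/
def walk (E : V → V → Prop) : Matrix V V ℝ := fun u v => if E u v then 1 / 3 else 0

theorem walk_of_edge {E : V → V → Prop} {u v : V} (h : E u v) : walk E u v = 1 / 3 := if_pos h

theorem walk_of_not_edge {E : V → V → Prop} {u v : V} (h : ¬ E u v) : walk E u v = 0 := if_neg h

theorem walk_congr {U : Type*} {E : V → V → Prop} {F : U → U → Prop} {u v : V} {u' v' : U}
    (h : E u v ↔ F u' v') : walk E u v = walk F u' v' := by
  by_cases hE : E u v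
  · rw [walk_of_edge hE, walk_of_edge (h.1 hE)]
  · rw [walk_of_not_edge hE, walk_of_not_edge fun hF => hE (h.2 hF)]

variable [Fintype V]

/-- Nonnegative entries and unit row sums. -/
def RowStochastic (P : Matrix V V ℝ) : Prop := (∀ x y, 0 ≤ P x y) ∧ ∀ x, ∑ y, P x y = 1

theorem RowStochastic.mul {P R : Matrix V V ℝ} (hP : RowStochastic P) (hR : RowStochastic R) :
    RowStochastic (P * R) := by
  refine ⟨fun x y => ?_, fun x => ?_⟩
  · rw [Matrix.mul_apply]
    exact Finset.sum_nonneg fun z _ => mul_nonneg (hP.1 _ _) (hR.1 _ _)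
  · simp only [Matrix.mul_apply]
    rw [Finset.sum_comm]
    simp only [← Finset.mul_sum, hR.2, mul_one, hP.2]

open Classical in
/-- Every vertex has in-degree and out-degree `3`. -/
def IsCubic (E : V → V → Prop) : Prop :=
  ∀ v, (univ.filter fun u => E u v).card = 3 ∧ (univ.filter fun w => E v w).card = 3

theorem IsCubic.rowStochastic {E : V → V → Prop} (h : IsCubic E) : RowStochastic (walk E) := by
  classical
  refine ⟨fun x y => ?_, fun x => ?_⟩
  · simp only [walk]; split_ifs <;> norm_num
  · simp only [walk, ← Finset.sum_filter, Finset.sum_const]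
    have := (h x).2
    rw [show (univ.filter fun w => E x w).card = 3 by convert this]
    norm_num

variable [DecidableEq V]

theorem RowStochastic.pow {P : Matrix V V ℝ} (hP : RowStochastic P) (k : ℕ) :
    RowStochastic (P ^ k) := by
  induction k with
  | zero =>
    refine ⟨fun x y => ?_, fun x => ?_⟩
    · rw [pow_zero, Matrix.one_apply]; split_ifs <;> norm_num
    · simp [Matrix.one_apply]
  | succ k ih => rw [pow_succ]; exact ih.mul hP

/-- The walk killed when it enters `b`. -/
def killed (P : Matrix V V ℝ) (b : V) : Matrix V V ℝ := fun x y => if y = b then 0 else P x y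

theorem killed_nonneg {P : Matrix V V ℝ} (hP : RowStochastic P) (b x y : V) :
    0 ≤ killed P b x y := by
  simp only [killed]; split_ifs
  · exact le_rfl
  · exact hP.1 _ _

theorem killed_le {P : Matrix V V ℝ} (hP : RowStochastic P) (b x y : V) :
    killed P b x y ≤ P x y := by
  simp only [killed]; split_ifs
  · exact hP.1 _ _
  · exact le_rfl

theorem Matrix.pow_entry_nonneg {P : Matrix V V ℝ} (hP : ∀ x y, 0 ≤ P x y) (k : ℕ) (x y : V) :
    0 ≤ (P ^ k) x y := by
  induction k generalizing y with
  | zero => rw [pow_zero, Matrix.one_apply]; split_ifs <;> norm_num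
  | succ k ih =>
    rw [pow_succ, Matrix.mul_apply]
    exact Finset.sum_nonneg fun z _ => mul_nonneg (ih _) (hP _ _)

/-- Entrywise comparison of powers along an embedding of the index sets. -/
theorem Matrix.pow_le_pow_of_embedding {U : Type*} [Fintype U] [DecidableEq U]
    {K : Matrix V V ℝ} {P : Matrix U U ℝ} (f : V ↪ U) (hK : ∀ x y, 0 ≤ K x y)
    (hP : ∀ x y, 0 ≤ P x y) (h : ∀ x y, K x y ≤ P (f x) (f y)) (k : ℕ) (x y : V) :
    (K ^ k) x y ≤ (P ^ k) (f x) (f y) := by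
  induction k generalizing y with
  | zero => simp [Matrix.one_apply]
  | succ k ih =>
    rw [pow_succ, pow_succ, Matrix.mul_apply, Matrix.mul_apply]
    calc ∑ z, (K ^ k) x z * K z y ≤ ∑ z, (P ^ k) (f x) (f z) * P (f z) (f y) :=
          Finset.sum_le_sum fun z _ => mul_le_mul (ih z) (h z y) (hK _ _)
            (Matrix.pow_entry_nonneg hP _ _ _)
      _ = ∑ z ∈ univ.map f, (P ^ k) (f x) z * P z (f y) := by rw [Finset.sum_map]
      _ ≤ _ := Finset.sum_le_univ_sum_of_nonneg fun z =>
          mul_nonneg (Matrix.pow_entry_nonneg hP _ _ _) (hP _ _)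

/-- Union bound on the time of the first visit to `b`. -/
theorem le_sum_killed_pow {P : Matrix V V ℝ} (hP : RowStochastic P) (b x : V) (k : ℕ) :
    1 - ∑ i ∈ range k, (P ^ (i + 1)) x b ≤ ∑ y, (killed P b ^ k) x y := by
  induction k with
  | zero => simp [Matrix.one_apply]
  | succ k ih =>
    have hrow : ∀ z, ∑ y, killed P b z y = 1 - P z b := by
      intro z
      have h := hP.2 z
      rw [← Finset.add_sum_erase _ _ (mem_univ b)] at h ⊢
      have : ∑ y ∈ univ.erase b, killed P b z y = ∑ y ∈ univ.erase b, P z y :=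
        Finset.sum_congr rfl fun y hy => by simp [killed, (Finset.mem_erase.1 hy).1]
      rw [this]
      simp only [killed, if_true]
      linarith
    have hsum : ∑ y, (killed P b ^ (k + 1)) x y
        = ∑ z, (killed P b ^ k) x z - ∑ z, (killed P b ^ k) x z * P z b := by
      simp only [pow_succ, Matrix.mul_apply]
      rw [Finset.sum_comm]
      simp only [← Finset.mul_sum, hrow, mul_sub, mul_one, Finset.sum_sub_distrib]
    have hle : ∑ z, (killed P b ^ k) x z * P z b ≤ (P ^ (k + 1)) x b := by
      rw [pow_succ, Matrix.mul_apply]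
      refine Finset.sum_le_sum fun z _ => mul_le_mul_of_nonneg_right ?_ (hP.1 _ _)
      exact Matrix.pow_le_pow_of_embedding (Function.Embedding.refl V) (killed_nonneg hP b) hP.1
        (killed_le hP b) k x z
    rw [Finset.sum_range_succ, hsum]
    linarith

/-- An entry of a product dominates each single term of its expansion. -/
theorem RowStochastic.mul_le_pow_add {P : Matrix V V ℝ} (hP : RowStochastic P) (i j : ℕ)
    (x z y : V) : (P ^ i) x z * (P ^ j) z y ≤ (P ^ (i + j)) x y := by
  rw [pow_add, Matrix.mul_apply]
  exact Finset.single_le_sum (f := fun z => (P ^ i) x z * (P ^ j) z y)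
    (fun w _ => mul_nonneg ((hP.pow i).1 _ _) ((hP.pow j).1 _ _)) (mem_univ z)

end Graph

section DeBruijn

/-- The de Bruijn digraph on words of length `p + 1` over three letters. -/
def deBruijn (p : ℕ) (x y : Fin (p + 1) → Fin 3) : Prop :=
  (fun i : Fin p => y i.castSucc) = Fin.tail x

theorem isCubic_deBruijn (p : ℕ) : IsCubic (deBruijn p) := by
  classical
  intro v
  constructor
  · rw [show (univ.filter fun u => deBruijn p u v)
        = univ.image (fun s : Fin 3 => (Fin.cons s fun i => v i.castSucc : Fin (p + 1) → Fin 3)) from ?_]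
    · rw [Finset.card_image_of_injective]
      · simp
      · intro s t h
        simpa using congrFun h 0
    · ext u
      rw [mem_filter_univ, mem_image]
      constructor
      · intro h
        exact ⟨u 0, mem_univ _, by
          rw [show (fun i : Fin p => v i.castSucc) = Fin.tail u from h, Fin.cons_self_tail]⟩
      · rintro ⟨s, -, rfl⟩
        simp [deBruijn]
  · rw [show (univ.filter fun u => deBruijn p v u)
        = univ.image (fun s : Fin 3 => (Fin.snoc (Fin.tail v) s : Fin (p + 1) → Fin 3)) from ?_]
    · rw [Finset.card_image_of_injective]
      · simp
      · intro s t h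
        simpa using congrFun h (Fin.last p)
    · ext u
      rw [mem_filter_univ, mem_image]
      constructor
      · intro h
        exact ⟨u (Fin.last p), mem_univ _, by
          rw [← show (fun i : Fin p => u i.castSucc) = Fin.tail v from h]
          exact Fin.snoc_init_self u⟩
      · rintro ⟨s, -, rfl⟩
        simp [deBruijn]

theorem deBruijn.apply {p : ℕ} {x y : Fin (p + 1) → Fin 3} (h : deBruijn p x y) (i : ℕ)
    (hi : i + 1 < p + 1) : y ⟨i, by omega⟩ = x ⟨i + 1, hi⟩ :=
  congrFun h ⟨i, by omega⟩

open Classical in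
/-- Up to time `p + 1` the first letters are forced and each admissible word has one path. -/
theorem deBruijn_pow_le_ite (p j : ℕ) (hj : j ≤ p + 1) (x y : Fin (p + 1) → Fin 3) :
    (walk (deBruijn p) ^ j) x y ≤
      if ∀ i (hi : i + j < p + 1), y ⟨i, by omega⟩ = x ⟨i + j, hi⟩ then (1 / 3 : ℝ) ^ j else 0 := by
  induction j generalizing y with
  | zero =>
    rw [pow_zero, Matrix.one_apply]
    split_ifs with h1 h2 h2
    · simp
    · exact absurd (fun i hi => by simp [h1]) h2
    · simp
    · exact le_rfl
  | succ j ih =>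
    have hst := (isCubic_deBruijn p).rowStochastic
    rw [pow_succ, Matrix.mul_apply]
    let z₀ : Fin (p + 1) → Fin 3 := Fin.cons (x ⟨j, by omega⟩) fun i => y i.castSucc
    have hz : ∀ z, z ≠ z₀ → (walk (deBruijn p) ^ j) x z * walk (deBruijn p) z y = 0 := by
      intro z hz
      by_contra hne
      have h1 : (walk (deBruijn p) ^ j) x z ≠ 0 := left_ne_zero_of_mul hne
      have h2 : walk (deBruijn p) z y ≠ 0 := right_ne_zero_of_mul hne
      have h2' : deBruijn p z y := by
        by_contra h
        exact h2 (by simp [walk, h])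
      have h1' := ih (by omega) z
      split_ifs at h1' with h
      · apply hz
        have h0 := h 0 (by omega)
        rw [← Fin.cons_self_tail z]
        simp only [z₀]
        rw [show (fun i : Fin p => y i.castSucc) = Fin.tail z from h2']
        congr 1
        simpa using h0
      · exact h1 (le_antisymm h1' ((hst.pow j).1 _ _))
    rw [Finset.sum_eq_single z₀ (fun z _ h => hz z h) (by simp)]
    have hw : walk (deBruijn p) z₀ y ≤ 1 / 3 := by
      simp only [walk]; split_ifs <;> norm_num
    have hih := ih (by omega) z₀
    split_ifs at hih ⊢ with h1 h2 h2
    · rw [pow_succ]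
      exact mul_le_mul hih hw (hst.1 _ _) (by positivity)
    · exact (mul_nonpos_of_nonpos_of_nonneg hih (hst.1 _ _)).trans (by positivity)
    · have : ¬ deBruijn p z₀ y := by
        intro hE
        apply h1
        intro i hi
        rw [hE.apply i (by omega), h2 (i + 1) (by omega)]
        congr 2
        omega
      simp [walk, this]
    · exact mul_nonpos_of_nonpos_of_nonneg hih (hst.1 _ _)

theorem deBruijn_pow_le (p j : ℕ) (hj : j ≤ p + 1) (x y : Fin (p + 1) → Fin 3) :
    (walk (deBruijn p) ^ j) x y ≤ (1 / 3 : ℝ) ^ j := by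
  classical
  refine (deBruijn_pow_le_ite p j hj x y).trans ?_
  split_ifs
  · exact le_rfl
  · positivity

theorem deBruijn_pow_add_le (p j : ℕ) (x y : Fin (p + 1) → Fin 3) :
    (walk (deBruijn p) ^ (j + (p + 1))) x y ≤ (1 / 3 : ℝ) ^ (p + 1) := by
  have hst := ((isCubic_deBruijn p).rowStochastic).pow j
  rw [pow_add, Matrix.mul_apply]
  calc _ ≤ ∑ z, (walk (deBruijn p) ^ j) x z * (1 / 3 : ℝ) ^ (p + 1) :=
        Finset.sum_le_sum fun z _ =>
          mul_le_mul_of_nonneg_left (deBruijn_pow_le p _ le_rfl z y) (hst.1 _ _)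
    _ = _ := by rw [← Finset.sum_mul, hst.2, one_mul]

theorem sum_range_third_pow (m : ℕ) :
    ∑ i ∈ range m, (1 / 3 : ℝ) ^ (i + 1) = (1 - (1 / 3) ^ m) / 2 := by
  induction m with
  | zero => simp
  | succ m ih => rw [Finset.sum_range_succ, ih]; ring

theorem succ_mul_third_pow_le (p : ℕ) : ((p : ℝ) + 1) * (1 / 3) ^ (p + 1) ≤ 1 / 3 := by
  induction p with
  | zero => norm_num
  | succ p ih =>
    rw [pow_succ]
    push_cast
    have : (0 : ℝ) ≤ (1 / 3 : ℝ) ^ (p + 1) := by positivity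
    have hp : (0 : ℝ) ≤ p := p.cast_nonneg
    nlinarith [mul_nonneg hp this]

theorem sixth_le_sum_killed_deBruijn (p j : ℕ) (hj : j ≤ p + 1) (b x : Fin (p + 1) → Fin 3) :
    1 / 6 ≤ ∑ y, (killed (walk (deBruijn p)) b ^ (j + (p + 1))) x y := by
  refine le_trans ?_ (le_sum_killed_pow (isCubic_deBruijn p).rowStochastic b x _)
  rw [add_comm j, Finset.sum_range_add]
  have h1 : ∑ i ∈ range (p + 1), (walk (deBruijn p) ^ (i + 1)) x b ≤ 1 / 2 := by
    calc _ ≤ ∑ i ∈ range (p + 1), (1 / 3 : ℝ) ^ (i + 1) :=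
          Finset.sum_le_sum fun i hi =>
            deBruijn_pow_le p _ (by have := Finset.mem_range.1 hi; omega) _ _
      _ ≤ 1 / 2 := by
          rw [sum_range_third_pow]
          have : (0 : ℝ) ≤ (1 / 3 : ℝ) ^ (p + 1) := by positivity
          linarith
  have h2 : ∑ i ∈ range j, (walk (deBruijn p) ^ (p + 1 + i + 1)) x b ≤ 1 / 3 := by
    calc _ ≤ ∑ i ∈ range j, (1 / 3 : ℝ) ^ (p + 1) :=
          Finset.sum_le_sum fun i _ => by
            rw [show p + 1 + i + 1 = (i + 1) + (p + 1) by ring]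
            exact deBruijn_pow_add_le p _ _ _
      _ = j * (1 / 3 : ℝ) ^ (p + 1) := by simp
      _ ≤ ((p : ℝ) + 1) * (1 / 3) ^ (p + 1) := by
          gcongr
          exact_mod_cast hj
      _ ≤ 1 / 3 := succ_mul_third_pow_le p
  linarith

end DeBruijn

section Gadget

/-- Vertices: words of the de Bruijn digraph, and a cyclic arrangement of `p + 1` layers of three. -/
abbrev GadgetVertex (p : ℕ) := (Fin (p + 1) → Fin 3) ⊕ (Fin (p + 1) × Fin 3)

/-- Disjoint union of the de Bruijn digraph and the blown-up directed cycle, whose layers are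
numbered decreasingly along the edges. -/
def unlinked (p : ℕ) : GadgetVertex p → GadgetVertex p → Prop
  | .inl x, .inl y => deBruijn p x y
  | .inr c, .inr c' => c.1 = c'.1 + 1
  | _, _ => False

theorem isCubic_unlinked (p : ℕ) : IsCubic (unlinked p) := by
  classical
  have hcard : ∀ i : Fin (p + 1), #{c : Fin (p + 1) × Fin 3 | c.1 = i} = 3 := by
    intro i
    rw [show (univ.filter fun c : Fin (p + 1) × Fin 3 => c.1 = i) = {i} ×ˢ univ by
      ext c; simp [Finset.mem_product, -singleton_product]]
    simp
  rintro (x | c) <;> constructor <;> rw [card_filter, Fintype.sum_sum_type]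
  · rw [Finset.sum_eq_zero (f := fun c => ite (unlinked p (.inr c) (.inl x)) 1 0)
      (fun _ _ => if_neg fun h => h), add_zero, ← card_filter]
    exact (isCubic_deBruijn p x).1
  · rw [Finset.sum_eq_zero (f := fun c => ite (unlinked p (.inl x) (.inr c)) 1 0)
      (fun _ _ => if_neg fun h => h), add_zero, ← card_filter]
    exact (isCubic_deBruijn p x).2
  · rw [Finset.sum_eq_zero (f := fun x => ite (unlinked p (.inl x) (.inr c)) 1 0)
      (fun _ _ => if_neg fun h => h), zero_add, ← card_filter]
    refine Eq.trans (congrArg card ?_) (hcard (c.1 + 1))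
    ext c'
    rw [mem_filter_univ, mem_filter_univ]
    rfl
  · rw [Finset.sum_eq_zero (f := fun x => ite (unlinked p (.inr c) (.inl x)) 1 0)
      (fun _ _ => if_neg fun h => h), zero_add, ← card_filter]
    refine Eq.trans (congrArg card ?_) (hcard (c.1 - 1))
    ext c'
    rw [mem_filter_univ, mem_filter_univ, eq_sub_iff_add_eq, eq_comm]
    rfl

/-- The unlinked digraph with the targets `0` (a word) and `(last, 0)` (a cycle vertex)
exchanged. -/
def gadget (p : ℕ) (u v : GadgetVertex p) : Prop :=
  unlinked p u (Equiv.swap (.inl 0) (.inr (Fin.last p, 0)) v)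

theorem isCubic_gadget (p : ℕ) : IsCubic (gadget p) := by
  classical
  intro v
  refine ⟨(isCubic_unlinked p _).1, ?_⟩
  refine Eq.trans ?_ (isCubic_unlinked p v).2
  exact Finset.card_equiv (Equiv.swap (.inl 0) (.inr (Fin.last p, 0))) fun w => by
    rw [mem_filter_univ, mem_filter_univ]
    rfl

theorem gadget_cycle {p : ℕ} {i j : Fin (p + 1)} {s t : Fin 3}
    (h : (j, t) ≠ (Fin.last p, 0)) (hij : i = j + 1) :
    gadget p (.inr (i, s)) (.inr (j, t)) := by
  rw [gadget, Equiv.swap_apply_of_ne_of_ne (by simp) (by simpa using h)]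
  exact hij

theorem gadget_exit (p : ℕ) (s : Fin 3) : gadget p (.inr (0, s)) (.inl 0) := by
  rw [gadget, Equiv.swap_apply_left]
  exact (Fin.last_add_one p).symm

theorem gadget_stay (p : ℕ) (s : Fin 3) : gadget p (.inr (0, s)) (.inr (Fin.last p, 1)) :=
  gadget_cycle (by simp) (Fin.last_add_one p).symm

theorem third_le_gadget_pow {p : ℕ} {z : GadgetVertex p} (hz : ∀ s, gadget p (.inr (0, s)) z)
    (m : ℕ) (hm : m < p + 1) (s : Fin 3) :
    1 / 3 ≤ (walk (gadget p) ^ (m + 1)) (.inr (⟨m, hm⟩, s)) z := by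
  have hst := (isCubic_gadget p).rowStochastic
  induction m generalizing s with
  | zero =>
    rw [zero_add, pow_one]
    exact (walk_of_edge (hz s)).ge
  | succ m ih =>
    rw [pow_succ', Matrix.mul_apply, Fintype.sum_sum_type, Fintype.sum_prod_type]
    have hlow : ∀ t, (1 / 3 : ℝ) * (1 / 3) ≤ walk (gadget p) (.inr (⟨m + 1, hm⟩, s))
        (.inr (⟨m, by omega⟩, t)) * (walk (gadget p) ^ (m + 1)) (.inr (⟨m, by omega⟩, t)) z := by
      intro t
      have hE : gadget p (.inr (⟨m + 1, hm⟩, s)) (.inr (⟨m, by omega⟩, t)) := by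
        refine gadget_cycle (fun h => ?_) ?_
        · have := congrArg (fun c => c.1.val) h
          simp at this
          omega
        · rw [Fin.ext_iff, Fin.val_add_one_of_lt]
          rw [Fin.lt_def]
          simp
          omega
      rw [walk_of_edge hE]
      exact mul_le_mul_of_nonneg_left (ih (by omega) t) (by norm_num)
    have hnn := fun w => mul_nonneg (hst.1 (.inr (⟨m + 1, hm⟩, s)) w) ((hst.pow (m + 1)).1 w z)
    have h1 : (1 : ℝ) / 3 ≤ ∑ t, walk (gadget p) (.inr (⟨m + 1, hm⟩, s))
        (.inr (⟨m, by omega⟩, t)) * (walk (gadget p) ^ (m + 1)) (.inr (⟨m, by omega⟩, t)) z :=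
      le_trans (by norm_num) (Finset.sum_le_sum fun t (_ : t ∈ univ) => hlow t)
    refine h1.trans (le_trans ?_ (le_add_of_nonneg_left (Finset.sum_nonneg fun _ _ => hnn _)))
    exact Finset.single_le_sum (f := fun i => ∑ t, walk (gadget p) (.inr (⟨m + 1, hm⟩, s))
        (.inr (i, t)) * (walk (gadget p) ^ (m + 1)) (.inr (i, t)) z)
      (fun _ _ => Finset.sum_nonneg fun _ _ => hnn _) (mem_univ _)

/-- Returning twice around the cycle keeps a point mass of order one. -/
theorem ninth_le_gadget_pow (p : ℕ) :
    1 / 9 ≤ (walk (gadget p) ^ (2 * (p + 1))) (.inr (Fin.last p, 1)) (.inr (Fin.last p, 1)) := by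
  have h := third_le_gadget_pow (gadget_stay p) p (by omega) 1
  rw [two_mul]
  refine le_trans ?_ ((isCubic_gadget p).rowStochastic.mul_le_pow_add _ _ _
    (.inr (Fin.last p, 1)) _)
  calc (1 / 9 : ℝ) = 1 / 3 * (1 / 3) := by norm_num
    _ ≤ _ := mul_le_mul h h (by norm_num) ((by norm_num : (0 : ℝ) ≤ 1 / 3).trans h)

theorem killed_deBruijn_pow_le_gadget (p k : ℕ) (x y : Fin (p + 1) → Fin 3) :
    (killed (walk (deBruijn p)) 0 ^ k) x y ≤ (walk (gadget p) ^ k) (.inl x) (.inl y) := by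
  refine Matrix.pow_le_pow_of_embedding Function.Embedding.inl
    (killed_nonneg (isCubic_deBruijn p).rowStochastic 0) (isCubic_gadget p).rowStochastic.1
    (fun x y => ?_) k x y
  by_cases hy : y = 0
  · simpa [killed, hy] using (isCubic_gadget p).rowStochastic.1 _ _
  · have : gadget p (.inl x) (.inl y) ↔ deBruijn p x y := by
      rw [gadget, Equiv.swap_apply_of_ne_of_ne (by simpa using hy) (by simp)]
      rfl
    rw [killed, if_neg hy]
    exact (walk_congr this).ge

theorem exists_spread_minorant (p : ℕ) (w : GadgetVertex p) :
    ∃ ν : (Fin (p + 1) → Fin 3) → ℝ, (∀ y, 0 ≤ ν y) ∧ (∀ y, ν y ≤ (1 / 3) ^ (p + 1)) ∧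
      (∀ y, ν y ≤ (walk (gadget p) ^ (2 * (p + 1))) w (.inl y)) ∧ 1 / 18 ≤ ∑ y, ν y := by
  have hH := (isCubic_deBruijn p).rowStochastic
  have hG := (isCubic_gadget p).rowStochastic
  have hnn : ∀ k x y, 0 ≤ (killed (walk (deBruijn p)) 0 ^ k) x y :=
    Matrix.pow_entry_nonneg (killed_nonneg hH 0)
  have hle : ∀ j x y, (killed (walk (deBruijn p)) 0 ^ (j + (p + 1))) x y ≤ (1 / 3) ^ (p + 1) :=
    fun j x y => (Matrix.pow_le_pow_of_embedding (Function.Embedding.refl _)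
      (killed_nonneg hH 0) hH.1 (killed_le hH 0) _ x y).trans (deBruijn_pow_add_le p j x y)
  rcases w with x | ⟨i, s⟩
  · refine ⟨fun y => (killed (walk (deBruijn p)) 0 ^ ((p + 1) + (p + 1))) x y,
      fun y => hnn _ _ _, fun y => hle _ _ _, fun y => ?_, ?_⟩
    · rw [two_mul]
      exact killed_deBruijn_pow_le_gadget p _ x y
    · exact le_trans (by norm_num) (sixth_le_sum_killed_deBruijn p (p + 1) le_rfl 0 x)
  · have hi := i.isLt
    refine ⟨fun y => 1 / 3 * (killed (walk (deBruijn p)) 0 ^ ((p - i) + (p + 1))) 0 y,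
      fun y => mul_nonneg (by norm_num) (hnn _ _ _), fun y => ?_, fun y => ?_, ?_⟩
    · linarith [hle (p - i) 0 y, hnn ((p - i) + (p + 1)) 0 y]
    · rw [show 2 * (p + 1) = (i + 1) + ((p - i) + (p + 1)) by omega]
      refine le_trans ?_ (hG.mul_le_pow_add _ _ _ (.inl 0) _)
      exact mul_le_mul (third_le_gadget_pow (gadget_exit p) i hi s)
        (killed_deBruijn_pow_le_gadget p _ 0 y) (hnn _ _ _) ((hG.pow _).1 _ _)
    · rw [← Finset.mul_sum]
      linarith [sixth_le_sum_killed_deBruijn p (p - i) (by omega) 0 0]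

end Gadget

section Double

variable {W : Type*} [Fintype W]

/-- Two disjoint copies of a digraph. -/
def double (E : W → W → Prop) (u v : W × Bool) : Prop := u.2 = v.2 ∧ E u.1 v.1

theorem IsCubic.double {E : W → W → Prop} (h : IsCubic E) : IsCubic (double E) := by
  classical
  rintro ⟨w, b⟩
  constructor
  · rw [← (h w).1]
    refine Finset.card_nbij' Prod.fst (fun u => (u, b)) ?_ ?_ ?_ ?_
    · intro u hu
      rw [Finset.mem_coe, mem_filter_univ] at hu ⊢
      exact hu.2
    · intro u hu
      rw [Finset.mem_coe, mem_filter_univ] at hu ⊢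
      exact ⟨rfl, hu⟩
    · intro u hu
      rw [Finset.mem_coe, mem_filter_univ] at hu
      exact Prod.ext rfl hu.1.symm
    · exact fun u _ => rfl
  · rw [← (h w).2]
    refine Finset.card_nbij' Prod.fst (fun u => (u, b)) ?_ ?_ ?_ ?_
    · intro u hu
      rw [Finset.mem_coe, mem_filter_univ] at hu ⊢
      exact hu.2
    · intro u hu
      rw [Finset.mem_coe, mem_filter_univ] at hu ⊢
      exact ⟨rfl, hu⟩
    · intro u hu
      rw [Finset.mem_coe, mem_filter_univ] at hu
      exact Prod.ext rfl hu.1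
    · exact fun u _ => rfl

theorem walk_double_pow [DecidableEq W] (E : W → W → Prop) (k : ℕ) (u v : W × Bool) :
    (walk (double E) ^ k) u v = if u.2 = v.2 then (walk E ^ k) u.1 v.1 else 0 := by
  induction k generalizing v with
  | zero => simp only [pow_zero, Matrix.one_apply, Prod.ext_iff]; split_ifs <;> simp_all
  | succ k ih =>
    obtain ⟨v, b⟩ := v
    rw [pow_succ, pow_succ, Matrix.mul_apply, Matrix.mul_apply, Fintype.sum_prod_type_right,
      Finset.sum_eq_single b]
    · have hwalk : ∀ z, walk (double E) (z, b) (v, b) = walk E z v :=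
        fun z => walk_congr ⟨fun h => h.2, fun h => ⟨rfl, h⟩⟩
      simp only [ih, hwalk]
      split_ifs <;> simp
    · intro c _ hc
      refine Finset.sum_eq_zero fun z _ => ?_
      rw [walk_of_not_edge fun h => hc h.1, mul_zero]
    · simp

end Double

section TotalVariation

variable {n : ℕ} {Q : Matrix (Fin n) (Fin n) ℝ}

theorem RowStochastic.tvFrom_add_le (hQ : RowStochastic Q) (s t : ℕ) (x : Fin n) :
    tvFrom Q (s + t) x ≤ ∑ z, (Q ^ s) x z * tvFrom Q t z := by
  have hs := hQ.pow s
  simp only [tvFrom, Finset.mul_sum]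
  rw [Finset.sum_comm]
  refine Finset.sum_le_sum fun y _ => max_le ?_ ?_
  · calc (1 : ℝ) / n - (Q ^ (s + t)) x y = ∑ z, (Q ^ s) x z * (1 / n - (Q ^ t) z y) := by
          simp only [mul_sub, Finset.sum_sub_distrib, ← Finset.sum_mul, hs.2, one_mul]
          rw [pow_add, Matrix.mul_apply]
      _ ≤ _ := Finset.sum_le_sum fun z _ => mul_le_mul_of_nonneg_left (le_max_left _ _) (hs.1 _ _)
  · exact Finset.sum_nonneg fun z _ => mul_nonneg (hs.1 _ _) (le_max_right _ _)

theorem tvFrom_le_worstTV (Q : Matrix (Fin n) (Fin n) ℝ) (t : ℕ) (x : Fin n) :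
    tvFrom Q t x ≤ worstTV Q t :=
  le_ciSup (Set.finite_range _).bddAbove x

theorem RowStochastic.worstTV_anti [NeZero n] (hQ : RowStochastic Q) {s t : ℕ} (h : s ≤ t) :
    worstTV Q t ≤ worstTV Q s := by
  obtain ⟨r, rfl⟩ := Nat.exists_eq_add_of_le' h
  refine ciSup_le fun x => (hQ.tvFrom_add_le r s x).trans ?_
  calc _ ≤ ∑ z, (Q ^ r) x z * worstTV Q s := Finset.sum_le_sum fun z _ =>
        mul_le_mul_of_nonneg_left (tvFrom_le_worstTV Q s z) ((hQ.pow r).1 _ _)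
    _ = _ := by rw [← Finset.sum_mul, (hQ.pow r).2, one_mul]

/-- Total variation distance dominates the discrepancy on every event. -/
theorem RowStochastic.abs_sub_le_tvFrom (hQ : RowStochastic Q) (t : ℕ) (x : Fin n)
    (A : Finset (Fin n)) : |∑ y ∈ A, (Q ^ t) x y - #A / n| ≤ tvFrom Q t x := by
  have hn : (n : ℝ) ≠ 0 := by
    have := x.pos
    positivity
  have hA : ∀ B : Finset (Fin n), #B / (n : ℝ) - ∑ y ∈ B, (Q ^ t) x y ≤ tvFrom Q t x := by
    intro B
    calc #B / (n : ℝ) - ∑ y ∈ B, (Q ^ t) x y = ∑ y ∈ B, ((1 : ℝ) / n - (Q ^ t) x y) := by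
          rw [Finset.sum_sub_distrib, Finset.sum_const, nsmul_eq_mul]; ring
      _ ≤ ∑ y ∈ B, max ((1 : ℝ) / n - (Q ^ t) x y) 0 :=
          Finset.sum_le_sum fun y _ => le_max_left _ _
      _ ≤ _ := Finset.sum_le_univ_sum_of_nonneg fun y => le_max_right _ _
  have h1 := hA A
  have h2 := hA Aᶜ
  have hsum := Finset.sum_add_sum_compl A fun y => (Q ^ t) x y
  rw [(hQ.pow t).2] at hsum
  have hcard : (#A : ℝ) / n + #Aᶜ / n = 1 := by
    rw [← add_div, ← Nat.cast_add, Finset.card_add_card_compl, Fintype.card_fin, div_self hn]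
  rw [abs_le]
  constructor <;> linarith

theorem mul_permMatrix_apply (P : Matrix (Fin n) (Fin n) ℝ) (π : Equiv.Perm (Fin n))
    (x y : Fin n) : (P * permMatrix π) x y = P x (π.symm y) := by
  rw [Matrix.mul_apply, Finset.sum_eq_single (π.symm y)]
  · simp [permMatrix]
  · intro z _ hz
    have : y ≠ π z := fun h => hz (by simp [h])
    simp [permMatrix, this]
  · simp

theorem RowStochastic.mul_permMatrix {P : Matrix (Fin n) (Fin n) ℝ} (hP : RowStochastic P)
    (π : Equiv.Perm (Fin n)) : RowStochastic (P * permMatrix π) := by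
  refine ⟨fun x y => ?_, fun x => ?_⟩
  · rw [mul_permMatrix_apply]; exact hP.1 _ _
  · simp only [mul_permMatrix_apply]
    rw [Equiv.sum_comp π.symm (P x), hP.2]

theorem worstTV_one_mul_permMatrix_le [NeZero n] {P : Matrix (Fin n) (Fin n) ℝ} {c : ℝ}
    (hc : ∀ x, c ≤ ∑ y, min ((1 : ℝ) / n) (P x y)) (π : Equiv.Perm (Fin n)) :
    worstTV (P * permMatrix π) 1 ≤ 1 - c := by
  refine ciSup_le fun x => ?_
  have hn : (n : ℝ) ≠ 0 := NeZero.ne _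
  calc tvFrom (P * permMatrix π) 1 x = ∑ y, max ((1 : ℝ) / n - P x (π.symm y)) 0 := by
        simp only [tvFrom, pow_one, mul_permMatrix_apply]
    _ = ∑ y, max ((1 : ℝ) / n - P x y) 0 :=
        Equiv.sum_comp π.symm fun y => max ((1 : ℝ) / n - P x y) 0
    _ = ∑ y, ((1 : ℝ) / n - min ((1 : ℝ) / n) (P x y)) := by
        refine Finset.sum_congr rfl fun y _ => ?_
        rcases le_total ((1 : ℝ) / n) (P x y) with h | h
        · rw [min_eq_left h, max_eq_right (by linarith), sub_self]
        · rw [min_eq_right h, max_eq_left (by linarith)]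
    _ ≤ 1 - c := by
        have : ∑ _y : Fin n, (1 : ℝ) / n = 1 := by simp [hn]
        rw [Finset.sum_sub_distrib, this]
        linarith [hc x]

end TotalVariation

section RandomPermutation

variable {n : ℕ}

theorem probPerm_mono {F G : Equiv.Perm (Fin n) → Prop} (h : ∀ π, F π → G π) :
    probPerm F ≤ probPerm G := by
  classical
  unfold probPerm
  gcongr
  exact h _

theorem probPerm_of_forall {F : Equiv.Perm (Fin n) → Prop} (h : ∀ π, F π) : probPerm F = 1 := by
  classical
  unfold probPerm
  rw [Finset.filter_true_of_mem fun π _ => h π, Finset.card_univ, div_self]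
  exact_mod_cast Fintype.card_ne_zero

/-- If `κ` exchanges `A` with its complement, a random permutation separates two given points
with probability at least one half. -/
theorem card_perm_le_two_mul_separating (A : Finset (Fin n)) {κ : Fin n → Fin n}
    (hκ : Function.Involutive κ) (hA : ∀ v, κ v ∈ A ↔ v ∉ A) {y y' : Fin n} (hy : y ≠ y') :
    Fintype.card (Equiv.Perm (Fin n)) ≤
      2 * #{π : Equiv.Perm (Fin n) | ¬ (π y ∈ A ↔ π y' ∈ A)} := by
  have hle : #{π : Equiv.Perm (Fin n) | (π y ∈ A ↔ π y' ∈ A)} ≤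
      #{π : Equiv.Perm (Fin n) | ¬ (π y ∈ A ↔ π y' ∈ A)} := by
    have hκne : ∀ π : Equiv.Perm (Fin n), (π y ∈ A ↔ π y' ∈ A) → π y ≠ κ (π y') := by
      intro π h he
      rw [he, hA] at h
      tauto
    refine Finset.card_le_card_of_injOn
      (fun π => Equiv.swap (π y') (κ (π y')) * π) ?_ ?_
    · intro π hπ
      simp only [Finset.coe_filter, mem_univ, true_and, Set.mem_ofPred_eq] at hπ ⊢
      rw [Equiv.Perm.mul_apply, Equiv.Perm.mul_apply, Equiv.swap_apply_left,
        Equiv.swap_apply_of_ne_of_ne (fun h => hy (π.injective h)) (hκne π hπ), hA, hπ]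
      tauto
    · intro π _ ρ _ h
      have h' : κ (π y') = κ (ρ y') := by
        simpa using congrArg (fun τ : Equiv.Perm (Fin n) => τ y') h
      have h'' : π y' = ρ y' := hκ.injective h'
      simp only [h''] at h
      exact mul_left_cancel h
  have := Finset.card_filter_add_card_filter_not (s := (univ : Finset (Equiv.Perm (Fin n))))
    (fun π => (π y ∈ A ↔ π y' ∈ A))
  rw [Finset.card_univ] at this
  omega

/-- Two steps of the permuted chain keep a bias between the two halves with probability at least
a quarter. -/
theorem quarter_le_probPerm_worstTV_two {P : Matrix (Fin n) (Fin n) ℝ} (hP : RowStochastic P)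
    (A : Finset (Fin n)) {κ : Fin n → Fin n} (hκ : Function.Involutive κ)
    (hA : ∀ v, κ v ∈ A ↔ v ∉ A) (hPA : ∀ u v, ¬ (u ∈ A ↔ v ∈ A) → P u v = 0)
    {x y : Fin n} {c : ℝ} (hc : c ≤ P x y) (hc0 : 0 < c) :
    1 / 4 ≤ probPerm fun π => c / 2 ≤ worstTV (P * permMatrix π) 2 := by
  classical
  have hxy : x ∈ A ↔ y ∈ A := by
    by_contra h
    linarith [hPA x y h]
  have hzero : P x (κ y) = 0 := hPA _ _ (by rw [hA, hxy]; tauto)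
  have hne : y ≠ κ y := fun h => by
    have := hA y
    rw [← h] at this
    tauto
  have hrowA : ∀ u, ∑ z ∈ A, P u z = if u ∈ A then 1 else 0 := by
    intro u
    split_ifs with hu
    · rw [← hP.2 u]
      exact Finset.sum_subset (subset_univ _) fun z _ hz => hPA u z (by tauto)
    · exact Finset.sum_eq_zero fun z hz => hPA u z (by tauto)
  let F : Equiv.Perm (Fin n) → ℝ := fun π => ∑ u, P x u * if π u ∈ A then 1 else 0
  have hF : ∀ π, |F π - #A / n| ≤ worstTV (P * permMatrix π) 2 := by
    intro π
    refine le_trans (le_of_eq ?_) (((hP.mul_permMatrix π).abs_sub_le_tvFrom 2 x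
      (A.map π.toEmbedding)).trans (tvFrom_le_worstTV _ 2 x))
    rw [Finset.card_map, Finset.sum_map]
    congr 2
    simp only [F, ← hrowA, Finset.mul_sum]
    rw [Finset.sum_comm]
    refine Finset.sum_congr rfl fun z _ => ?_
    rw [pow_two, Matrix.mul_apply, ← Equiv.sum_comp π.symm]
    simp [mul_permMatrix_apply]
  let τ : Equiv.Perm (Fin n) := Equiv.swap y (κ y)
  have hdiff : ∀ π : Equiv.Perm (Fin n), ¬ (π y ∈ A ↔ π (κ y) ∈ A) →
      c ≤ |F π - F (π * τ)| := by
    intro π hπ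
    have hval : F π - F (π * τ) =
        P x y * ((if π y ∈ A then 1 else 0) - if π (κ y) ∈ A then 1 else 0) := by
      simp only [F, ← Finset.sum_sub_distrib, ← mul_sub]
      rw [Finset.sum_eq_single y]
      · simp [τ]
      · intro u _ hu
        by_cases hu' : u = κ y
        · rw [hu', hzero, zero_mul]
        · simp [τ, Equiv.swap_apply_of_ne_of_ne hu hu']
      · simp
    rw [hval, abs_mul]
    refine hc.trans ((le_abs_self _).trans (le_mul_of_one_le_right (abs_nonneg _) ?_))
    by_cases h1 : π y ∈ A <;> by_cases h2 : π (κ y) ∈ A <;> simp [h1, h2] at hπ ⊢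
  let S : Finset (Equiv.Perm (Fin n)) := univ.filter fun π => c / 2 ≤ worstTV (P * permMatrix π) 2
  have hsep : #{π : Equiv.Perm (Fin n) | ¬ (π y ∈ A ↔ π (κ y) ∈ A)} ≤ 2 * #S := by
    refine (Finset.card_le_card (t := S ∪ S.map (Equiv.mulRight τ).toEmbedding) ?_).trans
      ((Finset.card_union_le _ _).trans (by rw [Finset.card_map, two_mul]))
    intro π hπ
    have hd := hdiff π (Finset.mem_filter.1 hπ).2
    rw [mem_union]
    by_contra! hcon
    have h1 : |F π - #A / n| < c / 2 := by
      have : ¬ c / 2 ≤ worstTV (P * permMatrix π) 2 := fun h => hcon.1 (mem_filter_univ _ |>.2 h)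
      linarith [hF π]
    have h2 : |F (π * τ) - #A / n| < c / 2 := by
      have : ¬ c / 2 ≤ worstTV (P * permMatrix (π * τ)) 2 := fun h =>
        hcon.2 (mem_map.2 ⟨π * τ, mem_filter_univ _ |>.2 h, by simp [τ, mul_assoc]⟩)
      linarith [hF (π * τ)]
    have h3 := abs_sub_le (F π) (#A / n) (F (π * τ))
    rw [abs_sub_comm ((#A : ℝ) / n)] at h3
    linarith
  have hcard := card_perm_le_two_mul_separating A hκ hA hne
  have hpos : (0 : ℝ) < Fintype.card (Equiv.Perm (Fin n)) := by exact_mod_cast Fintype.card_pos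
  have h4 : (Fintype.card (Equiv.Perm (Fin n)) : ℝ) ≤ 4 * #S := by
    exact_mod_cast (by omega : Fintype.card (Equiv.Perm (Fin n)) ≤ 4 * #S)
  rw [probPerm, le_div_iff₀ hpos]
  change _ ≤ (#S : ℝ)
  linarith

end RandomPermutation

section Assembly

/-- The properties of a digraph and a number of steps that rule out cutoff: after one step the distance
stays away from one, and after two steps it stays away from zero with probability at least `1 / 4`. -/
def ObstructsCutoff (n : ℕ) (E : Fin n → Fin n → Prop) (k : ℕ) : Prop :=
  (∀ π : Equiv.Perm (Fin n), ∀ t, 1 ≤ t →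
      worstTV (walkMatrix 3 E ^ k * permMatrix π) t ≤ 1 - 1 / 144) ∧
    ∀ t ≤ 2, 1 / 4 ≤ probPerm fun π : Equiv.Perm (Fin n) =>
      1 / 36 < worstTV (walkMatrix 3 E ^ k * permMatrix π) t

theorem card_double_gadgetVertex (p : ℕ) :
    Fintype.card (GadgetVertex p × Bool) = 2 * (3 ^ (p + 1) + 3 * (p + 1)) := by
  simp only [Fintype.card_prod, Fintype.card_sum, Fintype.card_fun, Fintype.card_fin,
    Fintype.card_bool]
  ring

theorem walkMatrix_pow_transport {V : Type*} [Fintype V] [DecidableEq V] {n : ℕ} (e : Fin n ≃ V)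
    (E : V → V → Prop) (k : ℕ) (u v : Fin n) :
    (walkMatrix 3 (fun u v => E (e u) (e v)) ^ k) u v = (walk E ^ k) (e u) (e v) := by
  have h : walkMatrix 3 (fun u v => E (e u) (e v)) = Matrix.reindexAlgEquiv ℝ ℝ e.symm (walk E) := by
    ext u v
    simp only [walkMatrix, walk, Matrix.coe_reindexAlgEquiv, Matrix.reindex_apply,
      Matrix.submatrix_apply, Equiv.symm_symm]
    norm_num
  rw [h, ← map_pow]
  simp

theorem isRegularDigraph_transport {V : Type*} [Fintype V] {n : ℕ} (e : Fin n ≃ V)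
    {E : V → V → Prop} (h : IsCubic E) : IsRegularDigraph 3 fun u v => E (e u) (e v) := by
  classical
  intro v
  refine ⟨Eq.trans ?_ (h (e v)).1, Eq.trans ?_ (h (e v)).2⟩ <;>
  exact Finset.card_equiv e fun w => by rw [mem_filter_univ, mem_filter_univ]

theorem succ_le_three_pow (p : ℕ) : p + 1 ≤ 3 ^ (p + 1) :=
  (Nat.lt_pow_self (by norm_num)).le

theorem spread_double_gadget (p : ℕ) (u : GadgetVertex p × Bool) :
    1 / 144 ≤ ∑ v, min ((1 : ℝ) / (2 * (3 ^ (p + 1) + 3 * (p + 1)) : ℕ))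
      ((walk (double (gadget p)) ^ (2 * (p + 1))) u v) := by
  obtain ⟨w, b⟩ := u
  obtain ⟨ν, hν0, hν1, hν2, hν3⟩ := exists_spread_minorant p w
  have hN : (1 / 3 : ℝ) ^ (p + 1) / 8 ≤ 1 / (2 * (3 ^ (p + 1) + 3 * (p + 1)) : ℕ) := by
    rw [one_div_pow, div_div]
    apply one_div_le_one_div_of_le (by positivity)
    have := succ_le_three_pow p
    exact_mod_cast (by omega : 2 * (3 ^ (p + 1) + 3 * (p + 1)) ≤ 3 ^ (p + 1) * 8)
  have hst := ((isCubic_gadget p).double.rowStochastic).pow (2 * (p + 1))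
  have hnn : ∀ v, 0 ≤ min ((1 : ℝ) / (2 * (3 ^ (p + 1) + 3 * (p + 1)) : ℕ))
      ((walk (double (gadget p)) ^ (2 * (p + 1))) (w, b) v) :=
    fun v => le_min (by positivity) (hst.1 _ _)
  let f : (Fin (p + 1) → Fin 3) ↪ GadgetVertex p × Bool :=
    ⟨fun y => (.inl y, b), fun y y' h => by simpa using h⟩
  refine le_trans ?_ (Finset.sum_le_univ_sum_of_nonneg (s := univ.map f) hnn)
  rw [Finset.sum_map]
  calc (1 : ℝ) / 144 ≤ ∑ y, ν y / 8 := by rw [← Finset.sum_div]; linarith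
    _ ≤ _ := Finset.sum_le_sum fun y _ => le_min ?_ ?_
  · linarith [hν1 y]
  · rw [walk_double_pow, if_pos (show b = (f y).2 from rfl)]
    exact le_trans (by linarith [hν0 y]) (hν2 y)

theorem exists_obstructsCutoff (p : ℕ) :
    ∃ E : Fin (2 * (3 ^ (p + 1) + 3 * (p + 1))) → Fin (2 * (3 ^ (p + 1) + 3 * (p + 1))) → Prop,
      IsRegularDigraph 3 E ∧ ObstructsCutoff _ E (2 * (p + 1)) := by
  classical
  obtain ⟨e'⟩ := Fintype.truncEquivFinOfCardEq (card_double_gadgetVertex p) |>.exists_rep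
  let e := e'.symm
  have : NeZero (2 * (3 ^ (p + 1) + 3 * (p + 1))) := ⟨by positivity⟩
  have hcub := (isCubic_gadget p).double
  refine ⟨fun u v => double (gadget p) (e u) (e v), isRegularDigraph_transport e hcub, ?_⟩
  have hpow := walkMatrix_pow_transport e (double (gadget p)) (2 * (p + 1))
  set P := walkMatrix 3 (fun u v => double (gadget p) (e u) (e v)) ^ (2 * (p + 1))
  have hP : RowStochastic P := by
    have hst := hcub.rowStochastic.pow (2 * (p + 1))
    refine ⟨fun x y => ?_, fun x => ?_⟩
    · rw [hpow]; exact hst.1 _ _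
    · simp only [hpow]
      rw [Equiv.sum_comp e ((walk (double (gadget p)) ^ (2 * (p + 1))) (e x)), hst.2]
  constructor
  · intro π t ht
    refine ((hP.mul_permMatrix π).worstTV_anti ht).trans (worstTV_one_mul_permMatrix_le ?_ π)
    intro x
    simp only [hpow]
    rw [Equiv.sum_comp e fun v => min ((1 : ℝ) / (2 * (3 ^ (p + 1) + 3 * (p + 1)) : ℕ))
      ((walk (double (gadget p)) ^ (2 * (p + 1))) (e x) v)]
    exact spread_double_gadget p (e x)
  · intro t ht
    let flip : GadgetVertex p × Bool → GadgetVertex p × Bool := fun u => (u.1, !u.2)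
    let x : GadgetVertex p × Bool := (.inr (Fin.last p, 1), true)
    have hmass : 1 / 9 ≤ P (e.symm x) (e.symm x) := by
      rw [hpow, walk_double_pow, if_pos rfl, Equiv.apply_symm_apply]
      exact ninth_le_gadget_pow p
    refine (quarter_le_probPerm_worstTV_two hP (univ.filter fun v => (e v).2 = true)
      (κ := fun v => e.symm (flip (e v))) (fun v => by simp [flip]) (fun v => by simp [flip])
      (fun u v huv => ?_) hmass (by norm_num)).trans (probPerm_mono fun π hπ => ?_)
    · rw [hpow, walk_double_pow, if_neg]
      intro h
      exact huv (by simp [h])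
    · have := (hP.mul_permMatrix π).worstTV_anti ht
      norm_num at hπ ⊢
      linarith

theorem log_size_le (p : ℕ) :
    1 / 4 * Real.log (2 * (3 ^ (p + 1) + 3 * (p + 1)) : ℕ) ≤ (2 * (p + 1) : ℕ) := by
  have h1 : Real.log (2 * (3 ^ (p + 1) + 3 * (p + 1)) : ℕ) ≤ Real.log (3 ^ (3 * (p + 1)) : ℕ) := by
    refine Real.log_le_log (by positivity) ?_
    have h := succ_le_three_pow p
    have h3 : 3 ≤ 3 ^ (p + 1) := Nat.le_self_pow (by omega) 3
    have : 2 * (3 ^ (p + 1) + 3 * (p + 1)) ≤ 3 ^ (3 * (p + 1)) := by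
      rw [mul_comm 3 (p + 1), pow_mul]
      generalize 3 ^ (p + 1) = N at *
      nlinarith [Nat.mul_le_mul h3 h3]
    exact_mod_cast this
  have h2 : Real.log 3 ≤ 2 := by
    have := Real.log_le_sub_one_of_pos (show (0 : ℝ) < 3 by norm_num)
    linarith
  push_cast at h1 ⊢
  rw [Real.log_pow] at h1
  push_cast at h1
  have hp : (0 : ℝ) ≤ p := p.cast_nonneg
  nlinarith

end Assembly

/-- Proposition 1.3: for `kₙ = Ω(log n)`, there are `d`-regular digraphs
for which the chain `Qₙ = Mₙ^{kₙ} Πₙ` (with `Πₙ` a uniformly random permutation) does not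
exhibit cutoff along an infinite set of sizes `n`. -/
theorem no_cutoff_exists :
    ∃ (d : ℕ), 2 ≤ d ∧ ∃ a > (0 : ℝ), ∃ S : Set ℕ, S.Infinite ∧
      ∃ (E : (n : ℕ) → Fin n → Fin n → Prop) (k : ℕ → ℕ),
        (∀ n ∈ S, IsRegularDigraph d (E n) ∧ 1 ≤ k n ∧ a * Real.log n ≤ (k n : ℝ)) ∧
        ¬ ∃ t : ℕ → ℕ, ∀ η ∈ Set.Ioo (0 : ℝ) 1,
          (∀ ζ > (0 : ℝ),
            Tendsto (fun n => probPerm (fun π : Equiv.Perm (Fin n) =>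
                ζ < worstTV ((walkMatrix d (E n)) ^ (k n) * permMatrix π)
                      ⌈(1 + η) * (t n : ℝ)⌉₊))
              (atTop ⊓ Filter.principal S) (nhds 0)) ∧
          (∀ ζ > (0 : ℝ),
            Tendsto (fun n => probPerm (fun π : Equiv.Perm (Fin n) =>
                ζ < |worstTV ((walkMatrix d (E n)) ^ (k n) * permMatrix π)
                      ⌊(1 - η) * (t n : ℝ)⌋₊ - 1|))
              (atTop ⊓ Filter.principal S) (nhds 0)) := by
  let S : Set ℕ := {n | ∃ (E : Fin n → Fin n → Prop) (k : ℕ),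
    (IsRegularDigraph 3 E ∧ 1 ≤ k ∧ 1 / 4 * Real.log n ≤ (k : ℝ)) ∧ ObstructsCutoff n E k}
  have hS : S.Infinite := by
    refine Set.infinite_of_injective_forall_mem
      (f := fun p : ℕ => 2 * (3 ^ (p + 1) + 3 * (p + 1))) ?_ fun p => ?_
    · refine StrictMono.injective (strictMono_nat_of_lt_succ fun p => ?_)
      have := Nat.pow_lt_pow_right (a := 3) (by norm_num) (Nat.lt_succ_self (p + 1))
      simp only [Nat.succ_eq_add_one] at this
      omega
    · obtain ⟨E, hE, hobs⟩ := exists_obstructsCutoff p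
      exact ⟨E, 2 * (p + 1), ⟨hE, by omega, log_size_le p⟩, hobs⟩
  have hchoice : ∀ n, ∃ (E : Fin n → Fin n → Prop) (k : ℕ), n ∈ S →
      (IsRegularDigraph 3 E ∧ 1 ≤ k ∧ 1 / 4 * Real.log n ≤ (k : ℝ)) ∧ ObstructsCutoff n E k := by
    intro n
    by_cases hn : n ∈ S
    · obtain ⟨E, k, h⟩ := hn
      exact ⟨E, k, fun _ => h⟩
    · exact ⟨fun _ _ => False, 0, fun h => absurd h hn⟩
  choose E k hEk using hchoice
  refine ⟨3, by norm_num, 1 / 4, by norm_num, S, hS, E, k, fun n hn => (hEk n hn).1, ?_⟩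
  rintro ⟨t, ht⟩
  obtain ⟨hup, hlow⟩ := ht (1 / 2) (by norm_num)
  have hup' := (hup (1 / 36) (by norm_num)).eventually (gt_mem_nhds (by norm_num : (0 : ℝ) < 1 / 4))
  have hlow' := (hlow (1 / 288) (by norm_num)).eventually
    (gt_mem_nhds (by norm_num : (0 : ℝ) < 1 / 4))
  have : (atTop ⊓ Filter.principal S).NeBot :=
    Filter.frequently_mem_iff_neBot.1 (Nat.frequently_atTop_iff_infinite.2 hS)
  have hmem : ∀ᶠ n in atTop ⊓ Filter.principal S, n ∈ S :=
    Filter.mem_inf_of_right (Filter.mem_principal_self S)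
  obtain ⟨n, ⟨h1, h2⟩, hn⟩ := ((hup'.and hlow').and hmem).exists
  obtain ⟨hone, htwo⟩ := (hEk n hn).2
  rcases le_or_gt (t n) 1 with hle | hgt
  · refine absurd (htwo _ (Nat.ceil_le.2 ?_)) (not_le.2 h1)
    have : (t n : ℝ) ≤ 1 := by exact_mod_cast hle
    norm_num
    linarith
  · have hfloor : 1 ≤ ⌊(1 - 1 / 2) * (t n : ℝ)⌋₊ := by
      rw [Nat.one_le_floor_iff]
      have : (2 : ℝ) ≤ t n := by exact_mod_cast hgt
      linarith
    rw [probPerm_of_forall] at h2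
    · norm_num at h2
    · intro π
      have := hone π _ hfloor
      rw [abs_sub_comm]
      exact lt_of_lt_of_le (by linarith) (le_abs_self _)

end
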